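/- Let Λ be a finitely aligned k-graph, let 𝓔 ⊆ FE(Λ) be satiated, and suppose F ∈ FE(Λ) \ 𝓔. Let x ∈ r(F)∂(Λ;𝓔) \ F∂(Λ;𝓔), and let n ∈ ℕ^k with n ≤ d(x). Let {t_λ : λ ∈ Λ} be a relative Cuntz-Krieger (Λ;𝓔)-family such that t_v ≠ 0 for every vertex v and ∏_{λ∈G}(t_{r(G)} − t_λt_λ*) ≠ 0 for every G ∈ FE(Λ) \ 𝓔. Then (∏_{λ∈F}(t_{r(F)} − t_λt_λ*)) t_{x(0,n)} t_{x(0,n)}* = t_{x(0,n)} (∏_{β∈Ext(x(0,n);F)}(t_{x(n)} − t_βt_β*)) t_{x(0,n)}*, and in particular this element is nonzero. -/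

import Mathlib

open scoped ENNReal

attribute [local instance] Classical.propDecidable

/-- Product of `f` over a set `S`, in some arbitrary order (junk value `1` if `S` is
infinite).  Used for products of commuting projections. -/
noncomputable def listProd {ι A : Type*} [Monoid A] (S : Set ι) (f : ι → A) : A :=
  if h : S.Finite then (h.toFinset.toList.map f).prod else 1

/-- A `k`-graph: a countable category `Λ` (whose morphisms are the terms of `Path`, with
vertices identified with the morphisms of degree `0`) together with a degree functor
`d : Λ → ℕ^k` satisfying the factorisation property. -/
structure KGraph (k : ℕ) where
  Path : Type
  countable : Countable Path
  d : Path → Fin k → ℕ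
  r : Path → Path
  s : Path → Path
  comp : Path → Path → Path
  d_r : ∀ lam, d (r lam) = 0
  d_s : ∀ lam, d (s lam) = 0
  r_r : ∀ lam, r (r lam) = r lam
  s_r : ∀ lam, s (r lam) = r lam
  r_s : ∀ lam, r (s lam) = s lam
  s_s : ∀ lam, s (s lam) = s lam
  comp_source : ∀ lam, comp lam (s lam) = lam
  range_comp : ∀ lam, comp (r lam) lam = lam
  r_comp : ∀ lam mu, s lam = r mu → r (comp lam mu) = r lam
  s_comp : ∀ lam mu, s lam = r mu → s (comp lam mu) = s mu
  d_comp : ∀ lam mu, s lam = r mu → d (comp lam mu) = d lam + d mu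
  comp_assoc : ∀ lam mu nu, s lam = r mu → s mu = r nu →
    comp (comp lam mu) nu = comp lam (comp mu nu)
  factor : ∀ lam m n, d lam = m + n →
    ∃! p : Path × Path, s p.1 = r p.2 ∧ d p.1 = m ∧ d p.2 = n ∧ comp p.1 p.2 = lam

namespace KGraph

variable {k : ℕ} (Λ : KGraph k)

/-- Vertices are identified with the paths of degree `0`. -/
def IsVertex (v : Λ.Path) : Prop := Λ.d v = 0

/-- The unique factorisation of `lam` as a product of a path of degree `m` and the
remaining tail (junk value if `¬ m ≤ d lam`). -/
noncomputable def split (lam : Λ.Path) (m : Fin k → ℕ) : Λ.Path × Λ.Path :=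
  if h : m ≤ Λ.d lam then
    (Λ.factor lam m (Λ.d lam - m) (by
      funext i
      exact (Nat.add_sub_cancel' (h i)).symm)).choose
  else (lam, lam)

/-- The segment `λ(m,n)` of the path `λ`: the unique path of degree `n - m` such that
`λ = λ(0,m) λ(m,n) λ(n, d λ)` (meaningful for `m ≤ n ≤ d λ`). -/
noncomputable def seg (lam : Λ.Path) (m n : Fin k → ℕ) : Λ.Path :=
  (Λ.split (Λ.split lam n).1 m).2

/-- `MCE(μ,ν)`: minimal common extensions of `μ` and `ν`. -/
def MCE (mu nu : Λ.Path) : Set Λ.Path :=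
  {lam | Λ.d lam = Λ.d mu ⊔ Λ.d nu ∧ Λ.seg lam 0 (Λ.d mu) = mu ∧ Λ.seg lam 0 (Λ.d nu) = nu}

/-- `Λ^min(μ,ν) = {(α,β) : μα = νβ ∈ MCE(μ,ν)}`. -/
def Lmin (mu nu : Λ.Path) : Set (Λ.Path × Λ.Path) :=
  {p | Λ.s mu = Λ.r p.1 ∧ Λ.s nu = Λ.r p.2 ∧ Λ.comp mu p.1 = Λ.comp nu p.2 ∧
    Λ.comp mu p.1 ∈ Λ.MCE mu nu}

/-- `Ext(μ;E)`: extensions of `μ` with respect to `E`. -/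
def Ext (mu : Λ.Path) (E : Set Λ.Path) : Set Λ.Path :=
  {a | Λ.r a = Λ.s mu ∧ ∃ nu ∈ E, ∃ b, (a, b) ∈ Λ.Lmin mu nu}

/-- `Λ` is finitely aligned if all the sets `MCE(μ,ν)` are finite. -/
def FinitelyAligned : Prop := ∀ mu nu, (Λ.MCE mu nu).Finite

/-- `E ⊆ vΛ` is exhaustive if `Ext(λ;E) ≠ ∅` for all `λ ∈ vΛ`. -/
def Exhaustive (v : Λ.Path) (E : Set Λ.Path) : Prop :=
  ∀ lam, Λ.r lam = v → (Λ.Ext lam E).Nonempty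

/-- `E ∈ vFE(Λ)`: `E ⊆ vΛ \ {v}` is finite and exhaustive (so `r(E) = v`). -/
def FEat (v : Λ.Path) (E : Set Λ.Path) : Prop :=
  Λ.IsVertex v ∧ (∀ lam ∈ E, Λ.r lam = v ∧ lam ≠ v) ∧ E.Finite ∧ Λ.Exhaustive v E

/-- `FE(Λ)`: the finite exhaustive sets. -/
def FE : Set (Set Λ.Path) := {E | ∃ v, Λ.FEat v E}

/-- `λE = {λμ : μ ∈ E, r(μ) = s(λ)}`. -/
def lamSet (lam : Λ.Path) (E : Set Λ.Path) : Set Λ.Path :=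
  {x | ∃ mu ∈ E, Λ.s lam = Λ.r mu ∧ Λ.comp lam mu = x}

/-- `EΛ = {λμ : λ ∈ E, r(μ) = s(λ)}`. -/
def setLam (E : Set Λ.Path) : Set Λ.Path :=
  {x | ∃ lam ∈ E, ∃ mu, Λ.s lam = Λ.r mu ∧ Λ.comp lam mu = x}

/-- `𝓔 ⊆ FE(Λ)` is satiated if it satisfies (S1)--(S4). -/
def Satiated (𝓔 : Set (Set Λ.Path)) : Prop :=
  𝓔 ⊆ Λ.FE ∧
  (∀ G ∈ 𝓔, ∀ E ∈ Λ.FE, G ⊆ E → E ∈ 𝓔) ∧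
  (∀ G ∈ 𝓔, ∀ v, Λ.FEat v G → ∀ mu, Λ.r mu = v → mu ∉ Λ.setLam G → Λ.Ext mu G ∈ 𝓔) ∧
  (∀ G ∈ 𝓔, ∀ n : Λ.Path → Fin k → ℕ, (∀ lam ∈ G, 0 < n lam ∧ n lam ≤ Λ.d lam) →
    ((fun lam => Λ.seg lam 0 (n lam)) '' G) ∈ 𝓔) ∧
  (∀ G ∈ 𝓔, ∀ G' ⊆ G, ∀ Gl : Λ.Path → Set Λ.Path,
    (∀ lam ∈ G', Gl lam ∈ 𝓔 ∧ Λ.FEat (Λ.s lam) (Gl lam)) →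
    ((G \ G') ∪ ⋃ lam ∈ G', Λ.lamSet lam (Gl lam)) ∈ 𝓔)

/-- The satiation `𝓔̄` of `𝓔`: the smallest satiated subset of `FE(Λ)` containing `𝓔`. -/
def satiation (𝓔 : Set (Set Λ.Path)) : Set (Set Λ.Path) :=
  ⋂₀ {F | 𝓔 ⊆ F ∧ Λ.Satiated F}

/-- `ΠE`: the smallest subset of `Λ` containing `E` which is closed under the operation
`(λ,μ,σ) ↦ λ Ext(μ;{σ})` for `λ,μ,σ ∈ ΠE` with `d(λ) = d(μ)`, `s(λ) = s(μ)`. -/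
def PiSet (E : Set Λ.Path) : Set Λ.Path :=
  ⋂₀ {G | E ⊆ G ∧ ∀ lam mu sig, lam ∈ G → mu ∈ G → sig ∈ G →
    Λ.d lam = Λ.d mu → Λ.s lam = Λ.s mu → Λ.lamSet lam (Λ.Ext mu {sig}) ⊆ G}

/-- `Σ₁(𝓔)`: finite sets `F ⊆ r(E)Λ \ Λ⁰` containing some `E ∈ 𝓔`. -/
def Sig1 (𝓔 : Set (Set Λ.Path)) : Set (Set Λ.Path) :=
  {F | ∃ E ∈ 𝓔, ∃ v, Λ.FEat v E ∧ E ⊆ F ∧ F.Finite ∧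
    ∀ lam ∈ F, Λ.r lam = v ∧ ¬ Λ.IsVertex lam}

/-- `Σ₂(𝓔) = {Ext(μ;E) : E ∈ 𝓔, μ ∈ r(E)Λ \ EΛ}`. -/
def Sig2 (𝓔 : Set (Set Λ.Path)) : Set (Set Λ.Path) :=
  {F | ∃ E ∈ 𝓔, ∃ v, Λ.FEat v E ∧ ∃ mu, Λ.r mu = v ∧ mu ∉ Λ.setLam E ∧ F = Λ.Ext mu E}

/-- `Σ₃(𝓔) = {{λ(0,n_λ) : λ ∈ E} : E ∈ 𝓔, 0 < n_λ ≤ d(λ)}`. -/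
def Sig3 (𝓔 : Set (Set Λ.Path)) : Set (Set Λ.Path) :=
  {F | ∃ E ∈ 𝓔, ∃ n : Λ.Path → Fin k → ℕ, (∀ lam ∈ E, 0 < n lam ∧ n lam ≤ Λ.d lam) ∧
    F = (fun lam => Λ.seg lam 0 (n lam)) '' E}

/-- `Σ₄(𝓔) = {(E \ F) ∪ ⋃_{λ ∈ F} λ F_λ : E ∈ 𝓔, F ⊆ E, F_λ ∈ s(λ)𝓔}`. -/
def Sig4 (𝓔 : Set (Set Λ.Path)) : Set (Set Λ.Path) :=
  {G | ∃ E ∈ 𝓔, ∃ F ⊆ E, ∃ Fl : Λ.Path → Set Λ.Path,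
    (∀ lam ∈ F, Fl lam ∈ 𝓔 ∧ Λ.FEat (Λ.s lam) (Fl lam)) ∧
    G = (E \ F) ∪ ⋃ lam ∈ F, Λ.lamSet lam (Fl lam)}

/-- `Σ = Σ₄ ∘ Σ₃ ∘ Σ₂ ∘ Σ₁`. -/
def SigmaStep (𝓔 : Set (Set Λ.Path)) : Set (Set Λ.Path) :=
  Λ.Sig4 (Λ.Sig3 (Λ.Sig2 (Λ.Sig1 𝓔)))

/-- `Σ^∞(𝓔) = ⋃_{n ≥ 1} Σ^n(𝓔)`. -/
def SigmaInf (𝓔 : Set (Set Λ.Path)) : Set (Set Λ.Path) :=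
  ⋃ n : ℕ, (Λ.SigmaStep)^[n + 1] 𝓔

section StarAlgebra

variable {A : Type*} [Ring A] [StarRing A]

/-- The product `∏_{λ ∈ E} (t_v - t_λ t_λ*)` (the factors pairwise commute for any
family satisfying (TCK1)--(TCK3), so the implicit choice of ordering is immaterial). -/
noncomputable def gapProd (t : Λ.Path → A) (v : Λ.Path) (E : Set Λ.Path) : A :=
  listProd E fun lam => t v - t lam * star (t lam)

/-- Conditions (TCK1)--(TCK3) on a family `{t_λ}`. -/
def TCKFamily (t : Λ.Path → A) : Prop :=
  (∀ v, Λ.IsVertex v → star (t v) = t v ∧ t v * t v = t v) ∧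
  (∀ v w, Λ.IsVertex v → Λ.IsVertex w → v ≠ w → t v * t w = 0) ∧
  (∀ lam mu, Λ.s lam = Λ.r mu → t lam * t mu = t (Λ.comp lam mu)) ∧
  (∀ lam mu, star (t lam) * t mu = ∑ᶠ p ∈ Λ.Lmin lam mu, t p.1 * star (t p.2))

/-- A relative Cuntz-Krieger `(Λ;𝓔)`-family: (TCK1)--(TCK3) together with (CK). -/
def RCKFamily (𝓔 : Set (Set Λ.Path)) (t : Λ.Path → A) : Prop :=
  Λ.TCKFamily t ∧ ∀ E ∈ 𝓔, ∀ v, Λ.FEat v E → Λ.gapProd t v E = 0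

/-- `Θ(t)^{ΠE}_{λ,μ} = t_λ (∏_{λν ∈ ΠE, d(ν) > 0} (t_{s(λ)} - t_ν t_ν*)) t_μ*`. -/
noncomputable def Theta (t : Λ.Path → A) (E : Set Λ.Path) (lam mu : Λ.Path) : A :=
  t lam *
    listProd {nu | Λ.s lam = Λ.r nu ∧ ¬ Λ.IsVertex nu ∧ Λ.comp lam nu ∈ Λ.PiSet E}
      (fun nu => t (Λ.s lam) - t nu * star (t nu)) *
    star (t mu)

end StarAlgebra

end KGraph

/-- A graph morphism `x : Ω_{k,m} → Λ`, encoded by its length `m = d(x) ∈ (ℕ∪{∞})^k`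
and its values `x(p,q)` on the morphisms `(p,q)` of `Ω_{k,m}` (with the junk value
`x(0,0)` outside the meaningful domain, so graph morphisms are extensional). -/
structure GMor {k : ℕ} (Λ : KGraph k) where
  len : Fin k → ℕ∞
  seg : (Fin k → ℕ) → (Fin k → ℕ) → Λ.Path
  d_seg : ∀ p q, p ≤ q → (∀ i, (q i : ℕ∞) ≤ len i) → Λ.d (seg p q) = q - p
  r_seg : ∀ p q, p ≤ q → (∀ i, (q i : ℕ∞) ≤ len i) → Λ.r (seg p q) = seg p p
  s_seg : ∀ p q, p ≤ q → (∀ i, (q i : ℕ∞) ≤ len i) → Λ.s (seg p q) = seg q q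
  comp_seg : ∀ p q u, p ≤ q → q ≤ u → (∀ i, (u i : ℕ∞) ≤ len i) →
    Λ.comp (seg p q) (seg q u) = seg p u
  seg_junk : ∀ p q, ¬ (p ≤ q ∧ ∀ i, (q i : ℕ∞) ≤ len i) → seg p q = seg 0 0

namespace GMor

variable {k : ℕ} {Λ : KGraph k}

/-- The range `r(x) = x(0)` of a graph morphism. -/
def range (x : GMor Λ) : Λ.Path := x.seg 0 0

/-- `y = x|_n^{d(x)}`, the restriction of `x` (defined for `n ≤ d(x)`):
`d(y) = d(x) - n` and `y(p,q) = x(n+p, n+q)`. -/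
def IsRestriction (y x : GMor Λ) (n : Fin k → ℕ) : Prop :=
  (∀ i, y.len i = x.len i - (n i : ℕ∞)) ∧
  ∀ p q, p ≤ q → (∀ i, (q i : ℕ∞) ≤ y.len i) → y.seg p q = x.seg (n + p) (n + q)

/-- `y = λx`, the extension of `x` by `λ ∈ Λ r(x)`: `d(y) = d(λ) + d(x)`,
`y(0, d(λ)) = λ` and `y(d(λ), d(λ)+n) = x(0,n)` for `n ≤ d(x)`. -/
def IsExtension (y : GMor Λ) (lam : Λ.Path) (x : GMor Λ) : Prop :=
  (∀ i, y.len i = (Λ.d lam i : ℕ∞) + x.len i) ∧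
  y.seg 0 (Λ.d lam) = lam ∧
  ∀ n : Fin k → ℕ, (∀ i, (n i : ℕ∞) ≤ x.len i) →
    y.seg (Λ.d lam) (Λ.d lam + n) = x.seg 0 n

/-- `x ∈ FΛ^∞`: `x` has an initial segment belonging to `F`. -/
def HasInit (x : GMor Λ) (F : Set Λ.Path) : Prop :=
  ∃ lam ∈ F, (∀ i, (Λ.d lam i : ℕ∞) ≤ x.len i) ∧ x.seg 0 (Λ.d lam) = lam

/-- `z` restricts to `x` on `Ω_{k, d(x)}`. -/
def Agrees (z x : GMor Λ) : Prop :=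
  ∀ p q, p ≤ q → (∀ i, (q i : ℕ∞) ≤ x.len i) → z.seg p q = x.seg p q

/-- `z ∈ MCE(x,y)` for graph morphisms `x, y`. -/
def IsMCE (z x y : GMor Λ) : Prop :=
  (∀ i, z.len i = max (x.len i) (y.len i)) ∧ z.Agrees x ∧ z.Agrees y

/-- `x` is aperiodic: for distinct `λ, μ ∈ Λ r(x)`, `MCE(λx, μx) = ∅`. -/
def Aperiodic (x : GMor Λ) : Prop :=
  ∀ lam mu : Λ.Path, lam ≠ mu → Λ.s lam = x.range → Λ.s mu = x.range →
    ∀ lx mx : GMor Λ, lx.IsExtension lam x → mx.IsExtension mu x →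
      ∀ z : GMor Λ, ¬ z.IsMCE lx mx

end GMor

namespace KGraph

variable {k : ℕ} (Λ : KGraph k)

/-- `x ∈ ∂(Λ;𝓔)`: an `𝓔`-compatible boundary path. -/
def IsBdry (𝓔 : Set (Set Λ.Path)) (x : GMor Λ) : Prop :=
  ∀ n : Fin k → ℕ, (∀ i, (n i : ℕ∞) ≤ x.len i) →
    ∀ E ∈ 𝓔, Λ.FEat (x.seg n n) E →
      ∃ lam ∈ E, (∀ i, ((n + Λ.d lam) i : ℕ∞) ≤ x.len i) ∧ x.seg n (n + Λ.d lam) = lam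

/-- Condition (C): aperiodic `𝓔`-compatible boundary paths out of every vertex, and
avoiding any given `F ∈ vFE(Λ) \ 𝓔`. -/
def CondC (𝓔 : Set (Set Λ.Path)) : Prop :=
  (∀ v, Λ.IsVertex v → ∃ x : GMor Λ, Λ.IsBdry 𝓔 x ∧ x.range = v ∧ x.Aperiodic) ∧
  (∀ v F, Λ.FEat v F → F ∉ 𝓔 →
    ∃ x : GMor Λ, Λ.IsBdry 𝓔 x ∧ x.range = v ∧ ¬ x.HasInit F ∧ x.Aperiodic)

end KGraph


section CommutingIdempotents

variable {ι A : Type*}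

/-- A product of commuting idempotents absorbs each of its factors. -/
theorem List.mul_prod_map_of_mem [Monoid A] {f : ι → A} {S : Set ι}
    (hc : ∀ a ∈ S, ∀ b ∈ S, Commute (f a) (f b)) (hi : ∀ a ∈ S, f a * f a = f a)
    {l : List ι} (hl : ∀ a ∈ l, a ∈ S) {a : ι} (ha : a ∈ l) :
    f a * (l.map f).prod = (l.map f).prod := by
  induction l with
  | nil => simp at ha
  | cons b l ih =>
    simp only [List.map_cons, List.prod_cons]
    rcases List.mem_cons.1 ha with rfl | h
    · rw [← mul_assoc, hi a (hl a ha)]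
    · rw [← mul_assoc, (hc a (hl a ha) b (hl b (by simp))).eq, mul_assoc,
        ih (fun c hc => hl c (by simp [hc])) h]

theorem List.prod_map_mul_prod_map_of_subset [Monoid A] {f : ι → A} {S : Set ι}
    (hc : ∀ a ∈ S, ∀ b ∈ S, Commute (f a) (f b)) (hi : ∀ a ∈ S, f a * f a = f a)
    {l l' : List ι} (hl' : ∀ a ∈ l', a ∈ S) (h : l ⊆ l') :
    (l.map f).prod * (l'.map f).prod = (l'.map f).prod := by
  induction l with
  | nil => simp
  | cons b l ih =>
    rw [List.map_cons, List.prod_cons, mul_assoc, ih (List.subset_of_cons_subset h),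
      List.mul_prod_map_of_mem hc hi hl' (h (by simp))]

/-- A product of commuting idempotents depends only on the set of its factors. -/
theorem List.prod_map_eq_of_mem_iff [Monoid A] {f : ι → A} {S : Set ι}
    (hc : ∀ a ∈ S, ∀ b ∈ S, Commute (f a) (f b)) (hi : ∀ a ∈ S, f a * f a = f a)
    {l l' : List ι} (hl : ∀ a, a ∈ l ↔ a ∈ S) (hl' : ∀ a, a ∈ l' ↔ a ∈ S) :
    (l.map f).prod = (l'.map f).prod := by
  have hcomm : Commute (l.map f).prod (l'.map f).prod := by
    refine Commute.list_prod_left _ _ fun y hy => ?_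
    refine Commute.list_prod_right _ _ fun z hz => ?_
    obtain ⟨a, ha, rfl⟩ := List.mem_map.1 hy
    obtain ⟨b, hb, rfl⟩ := List.mem_map.1 hz
    exact hc a ((hl a).1 ha) b ((hl' b).1 hb)
  rw [← List.prod_map_mul_prod_map_of_subset hc hi (l := l') (l' := l)
      (fun a => (hl a).1) (fun a ha => (hl a).2 ((hl' a).1 ha)), ← hcomm.eq]
  exact List.prod_map_mul_prod_map_of_subset hc hi
    (fun a => (hl' a).1) (fun a ha => (hl' a).2 ((hl a).1 ha))

/-- For pairwise orthogonal `q a` below the idempotent `p`, the product of the `p - q a` is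
`p - ∑ q a`. -/
theorem List.mul_prod_map_sub [Ring A] {p : A} (hp : p * p = p) {q : ι → A} {l : List ι}
    (hl : l.Nodup) (h1 : ∀ a ∈ l, p * q a = q a) (h2 : ∀ a ∈ l, q a * p = q a)
    (ho : ∀ a ∈ l, ∀ b ∈ l, a ≠ b → q a * q b = 0) :
    p * (l.map fun a => p - q a).prod = p - (l.map q).sum := by
  induction l with
  | nil => simp
  | cons a l ih =>
    have ha := h1 a (by simp)
    have ha' := h2 a (by simp)
    have hsum : q a * (l.map q).sum = 0 := by
      rw [← List.sum_map_mul_left]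
      refine List.sum_eq_zero fun x hx => ?_
      obtain ⟨b, hb, rfl⟩ := List.mem_map.1 hx
      exact ho a (by simp) b (by simp [hb]) (fun e => (List.nodup_cons.1 hl).1 (e ▸ hb))
    have hcomm : p * (p - q a) = (p - q a) * p := by rw [mul_sub, sub_mul, ha, ha']
    have hsum' : p * (l.map q).sum = (l.map q).sum := by
      rw [← List.sum_map_mul_left]
      congr 1
      exact List.map_congr_left fun b hb => h1 b (by simp [hb])
    rw [List.map_cons, List.prod_cons, ← mul_assoc, hcomm, mul_assoc,
      ih (List.nodup_cons.1 hl).2 (fun b hb => h1 b (by simp [hb]))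
        (fun b hb => h2 b (by simp [hb]))
        (fun b hb c hc => ho b (by simp [hb]) c (by simp [hc])),
      List.map_cons, List.sum_cons, sub_mul, mul_sub, mul_sub, hp, ha', hsum, hsum']
    abel

end CommutingIdempotents

namespace KGraph

variable {k : ℕ} (Λ : KGraph k)

theorem comp_inj {a b a' b' : Λ.Path} (h : Λ.s a = Λ.r b) (h' : Λ.s a' = Λ.r b')
    (hd : Λ.d a = Λ.d a') (hc : Λ.comp a b = Λ.comp a' b') : a = a' ∧ b = b' := by
  have hd' : Λ.d b = Λ.d b' := by
    have e := congrArg Λ.d hc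
    rw [Λ.d_comp _ _ h, Λ.d_comp _ _ h', hd] at e
    exact add_left_cancel e
  have := (Λ.factor _ _ _ (Λ.d_comp a b h)).unique (y₁ := (a, b)) (y₂ := (a', b'))
    ⟨h, rfl, rfl, rfl⟩ ⟨h', hd.symm, hd'.symm, hc.symm⟩
  exact Prod.ext_iff.1 this

theorem comp_left_cancel {a b b' : Λ.Path} (h : Λ.s a = Λ.r b) (h' : Λ.s a = Λ.r b')
    (hc : Λ.comp a b = Λ.comp a b') : b = b' :=
  (Λ.comp_inj h h' rfl hc).2

theorem exists_factor {lam : Λ.Path} {m : Fin k → ℕ} (hm : m ≤ Λ.d lam) :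
    ∃ a b, Λ.s a = Λ.r b ∧ Λ.d a = m ∧ Λ.comp a b = lam := by
  obtain ⟨p, hp, -⟩ := Λ.factor lam m (Λ.d lam - m) (add_tsub_cancel_of_le hm).symm
  exact ⟨p.1, p.2, hp.1, hp.2.1, hp.2.2.2⟩

theorem r_eq_self_of_isVertex {v : Λ.Path} (hv : Λ.IsVertex v) : Λ.r v = v := by
  refine (Λ.comp_inj (a := Λ.r v) (b := v) (a' := v) (b' := Λ.s v) (Λ.s_r v) (Λ.r_s v).symm
    ?_ ?_).1
  · rw [Λ.d_r]; exact hv.symm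
  · rw [Λ.range_comp, Λ.comp_source]

theorem split_comp {a b : Λ.Path} (h : Λ.s a = Λ.r b) :
    Λ.split (Λ.comp a b) (Λ.d a) = (a, b) := by
  have hle : Λ.d a ≤ Λ.d (Λ.comp a b) := by rw [Λ.d_comp _ _ h]; exact le_self_add
  rw [split, dif_pos hle]
  have hf := Λ.factor (Λ.comp a b) (Λ.d a) (Λ.d (Λ.comp a b) - Λ.d a)
    (add_tsub_cancel_of_le hle).symm
  refine hf.unique hf.choose_spec.1 ⟨h, rfl, ?_, rfl⟩
  rw [Λ.d_comp _ _ h, add_tsub_cancel_left]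

theorem seg_comp {a b : Λ.Path} (h : Λ.s a = Λ.r b) :
    Λ.seg (Λ.comp a b) 0 (Λ.d a) = a := by
  have := Λ.split_comp (Λ.s_r a)
  rw [Λ.range_comp, Λ.d_r] at this
  rw [seg, Λ.split_comp h, this]

theorem mem_Lmin_iff {mu nu : Λ.Path} {p : Λ.Path × Λ.Path} :
    p ∈ Λ.Lmin mu nu ↔ Λ.s mu = Λ.r p.1 ∧ Λ.s nu = Λ.r p.2 ∧
      Λ.comp mu p.1 = Λ.comp nu p.2 ∧ Λ.d (Λ.comp mu p.1) = Λ.d mu ⊔ Λ.d nu := by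
  constructor
  · rintro ⟨h1, h2, h3, h4, -, -⟩
    exact ⟨h1, h2, h3, h4⟩
  · rintro ⟨h1, h2, h3, h4⟩
    exact ⟨h1, h2, h3, h4, Λ.seg_comp h1, h3 ▸ Λ.seg_comp h2⟩

theorem swap_mem_Lmin {mu nu a b : Λ.Path} (h : (a, b) ∈ Λ.Lmin mu nu) :
    (b, a) ∈ Λ.Lmin nu mu := by
  obtain ⟨h1, h2, h3, h4⟩ := Λ.mem_Lmin_iff.1 h
  exact Λ.mem_Lmin_iff.2 ⟨h2, h1, h3.symm, by rw [← h3, h4, sup_comm]⟩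

theorem Lmin_snd_injOn (mu nu : Λ.Path) : Set.InjOn Prod.snd (Λ.Lmin mu nu) := by
  rintro ⟨a, b⟩ h ⟨a', b'⟩ h' (rfl : b = b')
  obtain ⟨h1, -, h3, -⟩ := h
  obtain ⟨h1', -, h3', -⟩ := h'
  exact Prod.ext (Λ.comp_left_cancel h1 h1' (h3.trans h3'.symm)) rfl

theorem Lmin_finite (hΛ : Λ.FinitelyAligned) (mu nu : Λ.Path) : (Λ.Lmin mu nu).Finite := by
  refine Set.Finite.of_finite_image (f := fun p => Λ.comp mu p.1)
    ((hΛ mu nu).subset ?_) ?_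
  · rintro _ ⟨p, hp, rfl⟩
    exact hp.2.2.2
  · rintro ⟨a, b⟩ ⟨h1, h2, h3, -⟩ ⟨a', b'⟩ ⟨h1', h2', h3', -⟩ (e : Λ.comp mu a = Λ.comp mu a')
    exact Prod.ext (Λ.comp_left_cancel h1 h1' e)
      (Λ.comp_left_cancel h2 h2' (h3.symm.trans (e.trans h3')))

theorem image_snd_Lmin (mu nu : Λ.Path) : Prod.snd '' Λ.Lmin nu mu = Λ.Ext mu {nu} := by
  ext b
  constructor
  · rintro ⟨⟨a, b⟩, h, rfl⟩
    exact ⟨h.2.1.symm, nu, rfl, a, Λ.swap_mem_Lmin h⟩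
  · rintro ⟨-, _, rfl, a, h⟩
    exact ⟨(a, b), Λ.swap_mem_Lmin h, rfl⟩

theorem Ext_singleton_finite (hΛ : Λ.FinitelyAligned) (mu nu : Λ.Path) :
    (Λ.Ext mu {nu}).Finite := by
  rw [← Λ.image_snd_Lmin]
  exact (Λ.Lmin_finite hΛ nu mu).image _

theorem mem_Ext_iff {mu a : Λ.Path} {E : Set Λ.Path} :
    a ∈ Λ.Ext mu E ↔ ∃ nu ∈ E, a ∈ Λ.Ext mu {nu} := by
  simp only [Ext, Set.mem_ofPred_eq, Set.mem_singleton_iff, exists_eq_left]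
  tauto

theorem Ext_finite (hΛ : Λ.FinitelyAligned) (mu : Λ.Path) {E : Set Λ.Path} (hE : E.Finite) :
    (Λ.Ext mu E).Finite := by
  refine (hE.biUnion fun nu _ => Λ.Ext_singleton_finite hΛ mu nu).subset fun a ha => ?_
  simpa using Λ.mem_Ext_iff.1 ha

theorem d_eq_of_mem_Ext_singleton {mu nu a : Λ.Path} (h : a ∈ Λ.Ext mu {nu}) :
    Λ.d a = Λ.d mu ⊔ Λ.d nu - Λ.d mu := by
  obtain ⟨-, _, rfl, b, h⟩ := h
  obtain ⟨h1, -, -, h4⟩ := Λ.mem_Lmin_iff.1 h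
  rw [← h4, Λ.d_comp _ _ h1, add_tsub_cancel_left]

/-- Two paths with a common extension have a minimal one, through which it factors. -/
theorem exists_mem_Lmin {mu nu a b : Λ.Path} (ha : Λ.s mu = Λ.r a) (hb : Λ.s nu = Λ.r b)
    (h : Λ.comp mu a = Λ.comp nu b) :
    ∃ a' b' c, (a', b') ∈ Λ.Lmin mu nu ∧ Λ.s a' = Λ.r c ∧ Λ.comp a' c = a := by
  have hda := Λ.d_comp _ _ ha
  have hdb := Λ.d_comp _ _ hb
  have hle : Λ.d mu ⊔ Λ.d nu ≤ Λ.d (Λ.comp mu a) :=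
    sup_le (hda ▸ le_self_add) (h ▸ hdb ▸ le_self_add)
  obtain ⟨rho, c, hrc, hd, hcomp⟩ := Λ.exists_factor hle
  have key : ∀ sig e, Λ.s sig = Λ.r e → Λ.comp sig e = Λ.comp mu a → Λ.d sig ≤ Λ.d rho →
      ∃ e', Λ.s sig = Λ.r e' ∧ Λ.comp sig e' = rho ∧ Λ.s e' = Λ.r c ∧ Λ.comp e' c = e := by
    intro sig e hs he hdle
    obtain ⟨u, e', hue, hdu, rfl⟩ := Λ.exists_factor hdle
    rw [Λ.s_comp _ _ hue] at hrc
    rw [Λ.comp_assoc _ _ _ hue hrc] at hcomp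
    have hu : Λ.s u = Λ.r (Λ.comp e' c) := by rw [Λ.r_comp _ _ hrc, hue]
    obtain ⟨rfl, rfl⟩ := Λ.comp_inj hu hs hdu (hcomp.trans he.symm)
    exact ⟨e', hue, rfl, hrc, rfl⟩
  obtain ⟨a', h1, h2, h3, h4⟩ := key mu a ha rfl (hd ▸ le_sup_left)
  obtain ⟨b', h1', h2', -, -⟩ := key nu b hb h.symm (hd ▸ le_sup_right)
  exact ⟨a', b', c, Λ.mem_Lmin_iff.2 ⟨h1, h1', h2.trans h2'.symm, by rw [h2, hd]⟩, h3, h4⟩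

theorem exhaustive_Ext {v mu : Λ.Path} {E : Set Λ.Path} (hE : Λ.Exhaustive v E)
    (hmu : Λ.r mu = v) : Λ.Exhaustive (Λ.s mu) (Λ.Ext mu E) := by
  intro lam hlam
  obtain ⟨a, har, nu, hnu, b, h⟩ := hE (Λ.comp mu lam) (by rw [Λ.r_comp _ _ hlam.symm, hmu])
  rw [Λ.s_comp _ _ hlam.symm] at har
  obtain ⟨-, h2, h3, -⟩ := Λ.mem_Lmin_iff.1 h
  rw [Λ.comp_assoc _ _ _ hlam.symm har.symm] at h3
  have hr : Λ.s mu = Λ.r (Λ.comp lam a) := by rw [Λ.r_comp _ _ har.symm, hlam]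
  obtain ⟨a', b', c, hm, hc, hac⟩ := Λ.exists_mem_Lmin hr h2 h3
  obtain ⟨e, e', -, hm', -, -⟩ := Λ.exists_mem_Lmin har.symm hc hac.symm
  exact ⟨e, hm'.1.symm, a', ⟨hm.1.symm, nu, hnu, b', hm⟩, e', hm'⟩

theorem FEat_Ext (hΛ : Λ.FinitelyAligned) {v mu : Λ.Path} {E : Set Λ.Path} (hE : Λ.FEat v E)
    (hmu : Λ.r mu = v) (hmuE : mu ∉ Λ.setLam E) : Λ.FEat (Λ.s mu) (Λ.Ext mu E) := by
  refine ⟨Λ.d_s mu, ?_, Λ.Ext_finite hΛ mu hE.2.2.1, Λ.exhaustive_Ext hE.2.2.2 hmu⟩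
  rintro a ⟨har, nu, hnu, b, h⟩
  refine ⟨har, ?_⟩
  rintro rfl
  obtain ⟨-, h2, h3, -⟩ := h
  exact hmuE ⟨nu, hnu, b, h2, by rw [← h3, Λ.comp_source]⟩

section StarAlgebra

variable {Λ} {A : Type*} [Ring A] [StarRing A] {t : Λ.Path → A}

theorem TCKFamily.mul_source (ht : Λ.TCKFamily t) (lam : Λ.Path) :
    t lam * t (Λ.s lam) = t lam := by
  rw [ht.2.2.1 _ _ (Λ.r_s lam).symm, Λ.comp_source]

theorem TCKFamily.range_mul (ht : Λ.TCKFamily t) (lam : Λ.Path) :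
    t (Λ.r lam) * t lam = t lam := by
  rw [ht.2.2.1 _ _ (Λ.s_r lam), Λ.range_comp]

theorem TCKFamily.star_mul_range (ht : Λ.TCKFamily t) (lam : Λ.Path) :
    star (t lam) * t (Λ.r lam) = star (t lam) := by
  have := congrArg star (ht.range_mul lam)
  rwa [star_mul, (ht.1 _ (Λ.d_r lam)).1] at this

theorem TCKFamily.star_mul_self (ht : Λ.TCKFamily t) (lam : Λ.Path) :
    star (t lam) * t lam = t (Λ.s lam) := by
  have hL : Λ.Lmin lam lam = {(Λ.s lam, Λ.s lam)} := by
    ext ⟨a, b⟩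
    rw [Λ.mem_Lmin_iff, Set.mem_singleton_iff]
    constructor
    · rintro ⟨h1, h2, h3, h4⟩
      dsimp only at h1 h2 h3 h4
      rw [Λ.d_comp _ _ h1, sup_idem] at h4
      obtain rfl := Λ.comp_left_cancel h1 h2 h3
      have : a = Λ.s lam := by
        rw [h1, Λ.r_eq_self_of_isVertex (left_eq_add.1 h4.symm)]
      rw [this]
    · intro h
      obtain ⟨rfl, rfl⟩ := Prod.ext_iff.1 h
      exact ⟨(Λ.r_s _).symm, (Λ.r_s _).symm, rfl, by simp [Λ.comp_source]⟩
  obtain ⟨h1, h2⟩ := ht.1 _ (Λ.d_s lam)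
  rw [ht.2.2.2, hL, finsum_mem_singleton, h1, h2]

theorem TCKFamily.star_mul_of_ne (ht : Λ.TCKFamily t) {lam mu : Λ.Path}
    (hd : Λ.d lam = Λ.d mu) (hne : lam ≠ mu) : star (t lam) * t mu = 0 := by
  have hL : Λ.Lmin lam mu = ∅ := by
    refine Set.eq_empty_of_forall_notMem ?_
    rintro ⟨a, b⟩ ⟨h1, h2, h3, -⟩
    exact hne (Λ.comp_inj h1 h2 hd h3).1
  rw [ht.2.2.2, hL, finsum_mem_empty]

theorem TCKFamily.rangeProj_mul_self (ht : Λ.TCKFamily t) (lam : Λ.Path) :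
    t lam * star (t lam) * (t lam * star (t lam)) = t lam * star (t lam) := by
  rw [mul_assoc, ← mul_assoc (star _), ht.star_mul_self, ← mul_assoc, ht.mul_source]

/-- The range projection of `lam` moves past `t mu` to the range projections of
`Ext(mu; {lam})`. -/
theorem TCKFamily.rangeProj_mul (ht : Λ.TCKFamily t) (hΛ : Λ.FinitelyAligned)
    (lam mu : Λ.Path) :
    t lam * star (t lam) * t mu =
      t mu * ∑ b ∈ (Λ.Ext_singleton_finite hΛ mu lam).toFinset, t b * star (t b) := by
  have hL := Λ.Lmin_finite hΛ lam mu
  have himg : (Λ.Ext_singleton_finite hΛ mu lam).toFinset = hL.toFinset.image Prod.snd := by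
    ext b
    rw [Set.Finite.mem_toFinset, ← Λ.image_snd_Lmin]
    simp
  rw [mul_assoc, ht.2.2.2, finsum_mem_eq_finite_toFinset_sum _ hL, himg,
    Finset.sum_image (by simpa using Λ.Lmin_snd_injOn lam mu), Finset.mul_sum, Finset.mul_sum]
  refine Finset.sum_congr rfl fun p hp => ?_
  obtain ⟨h1, h2, h3, -⟩ := hL.mem_toFinset.1 hp
  rw [← mul_assoc, ← mul_assoc, ht.2.2.1 _ _ h1, ht.2.2.1 _ _ h2, h3]

theorem TCKFamily.rangeProj_commute (ht : Λ.TCKFamily t) (hΛ : Λ.FinitelyAligned)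
    (lam mu : Λ.Path) : Commute (t lam * star (t lam)) (t mu * star (t mu)) := by
  have h : t lam * star (t lam) * (t mu * star (t mu)) = t mu *
      (∑ b ∈ (Λ.Ext_singleton_finite hΛ mu lam).toFinset, t b * star (t b)) *
        star (t mu) := by
    rw [← mul_assoc, ht.rangeProj_mul hΛ]
  have hs := congrArg star h
  simp only [star_mul, star_star, star_sum] at hs
  rw [← mul_assoc (t mu), ← h] at hs
  exact hs.symm

section Gap

variable {w : Λ.Path} {E : Set Λ.Path}

theorem TCKFamily.gap_commute (ht : Λ.TCKFamily t) (hΛ : Λ.FinitelyAligned)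
    {a b : Λ.Path} (ha : Λ.r a = w) (hb : Λ.r b = w) :
    Commute (t w - t a * star (t a)) (t w - t b * star (t b)) := by
  have key : ∀ c, Λ.r c = w → Commute (t w) (t c * star (t c)) := by
    rintro c rfl
    rw [Commute, SemiconjBy, ← mul_assoc, ht.range_mul, mul_assoc, ht.star_mul_range]
  exact ((Commute.refl _).sub_right (key b hb)).sub_left
    ((key a ha).symm.sub_right (ht.rangeProj_commute hΛ a b))

theorem TCKFamily.mul_gap (ht : Λ.TCKFamily t) {a : Λ.Path} (ha : Λ.r a = w) :
    t w * (t w - t a * star (t a)) = t w - t a * star (t a) := by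
  subst ha
  rw [mul_sub, (ht.1 _ (Λ.d_r a)).2, ← mul_assoc, ht.range_mul]

theorem TCKFamily.gap_mul (ht : Λ.TCKFamily t) {a : Λ.Path} (ha : Λ.r a = w) :
    (t w - t a * star (t a)) * t w = t w - t a * star (t a) := by
  subst ha
  rw [sub_mul, (ht.1 _ (Λ.d_r a)).2, mul_assoc, ht.star_mul_range]

theorem TCKFamily.gap_mul_self (ht : Λ.TCKFamily t) {a : Λ.Path} (ha : Λ.r a = w) :
    (t w - t a * star (t a)) * (t w - t a * star (t a)) = t w - t a * star (t a) := by
  rw [mul_sub, ht.gap_mul ha, sub_mul, ht.rangeProj_mul_self]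
  subst ha
  rw [← mul_assoc (t (Λ.r a)), ht.range_mul, sub_self, sub_zero]

theorem TCKFamily.prod_map_gap_eq (ht : Λ.TCKFamily t) (hΛ : Λ.FinitelyAligned)
    (hE : ∀ a ∈ E, Λ.r a = w) {l l' : List Λ.Path} (hl : ∀ a, a ∈ l ↔ a ∈ E)
    (hl' : ∀ a, a ∈ l' ↔ a ∈ E) :
    (l.map fun a => t w - t a * star (t a)).prod =
      (l'.map fun a => t w - t a * star (t a)).prod :=
  List.prod_map_eq_of_mem_iff (fun a ha b hb => ht.gap_commute hΛ (hE a ha) (hE b hb))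
    (fun a ha => ht.gap_mul_self (hE a ha)) hl hl'

theorem TCKFamily.mul_gapProd_mul (ht : Λ.TCKFamily t) (hE : ∀ a ∈ E, Λ.r a = w)
    (hfin : E.Finite) (hne : E.Nonempty) :
    t w * Λ.gapProd t w E * t w = Λ.gapProd t w E := by
  have key : ∀ l : List Λ.Path, l ≠ [] → (∀ a ∈ l, Λ.r a = w) →
      t w * (l.map fun a => t w - t a * star (t a)).prod =
        (l.map fun a => t w - t a * star (t a)).prod ∧
      (l.map fun a => t w - t a * star (t a)).prod * t w =
        (l.map fun a => t w - t a * star (t a)).prod := by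
    intro l hl hr
    constructor
    · cases l with
      | nil => exact absurd rfl hl
      | cons a l =>
        rw [List.map_cons, List.prod_cons, ← mul_assoc, ht.mul_gap (hr a (by simp))]
    · induction l using List.reverseRecOn with
      | nil => exact absurd rfl hl
      | append_singleton l a =>
        rw [List.map_append, List.prod_append, List.map_singleton, List.prod_singleton,
          mul_assoc, ht.gap_mul (hr a (by simp))]
  rw [gapProd, listProd, dif_pos hfin]
  obtain ⟨h1, h2⟩ := key hfin.toFinset.toList (by simpa using hne.ne_empty)
    (fun a ha => hE a (by simpa using ha))
  rw [h1, h2]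

/-- A single gap projection moves past `t mu`. -/
theorem TCKFamily.gap_mul_eq (ht : Λ.TCKFamily t) (hΛ : Λ.FinitelyAligned)
    {lam mu : Λ.Path} (hr : Λ.r mu = w) :
    (t w - t lam * star (t lam)) * t mu =
      t mu * ((Λ.Ext_singleton_finite hΛ mu lam).toFinset.toList.map
        fun b => t (Λ.s mu) - t b * star (t b)).prod := by
  set S := (Λ.Ext_singleton_finite hΛ mu lam).toFinset with hS
  have hmem : ∀ b ∈ S.toList, b ∈ Λ.Ext mu {lam} := fun b hb => by simpa [hS] using hb
  have key := List.mul_prod_map_sub (ht.1 _ (Λ.d_s mu)).2 (q := fun b => t b * star (t b))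
    S.nodup_toList
    (fun b hb => by rw [← (hmem b hb).1, ← mul_assoc, ht.range_mul])
    (fun b hb => by rw [← (hmem b hb).1, mul_assoc, ht.star_mul_range])
    (fun b hb c hc hne => by
      have hd : Λ.d b = Λ.d c := by
        rw [Λ.d_eq_of_mem_Ext_singleton (hmem b hb), Λ.d_eq_of_mem_Ext_singleton (hmem c hc)]
      rw [mul_assoc, ← mul_assoc (star _), ht.star_mul_of_ne hd hne, zero_mul, mul_zero])
  subst hr
  rw [sub_mul, ht.range_mul, ht.rangeProj_mul hΛ, ← hS, ← Finset.sum_map_toList,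
    ← ht.mul_source mu, mul_assoc, mul_assoc, key, mul_sub, ht.mul_source,
    ← mul_assoc, ht.mul_source]

theorem TCKFamily.gapProd_mul (ht : Λ.TCKFamily t) (hΛ : Λ.FinitelyAligned)
    (hE : E.Finite) {mu : Λ.Path} (hr : Λ.r mu = w) :
    Λ.gapProd t w E * t mu = t mu * Λ.gapProd t (Λ.s mu) (Λ.Ext mu E) := by
  have hlist : ∀ l : List Λ.Path, (l.map fun a => t w - t a * star (t a)).prod * t mu =
      t mu * ((l.flatMap fun lam => (Λ.Ext_singleton_finite hΛ mu lam).toFinset.toList).map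
        fun b => t (Λ.s mu) - t b * star (t b)).prod := by
    intro l
    induction l with
    | nil => simp
    | cons a l ih =>
      rw [List.map_cons, List.prod_cons, mul_assoc, ih, ← mul_assoc, ht.gap_mul_eq hΛ hr,
        List.flatMap_cons, List.map_append, List.prod_append, mul_assoc]
  have hfin := Λ.Ext_finite hΛ mu hE
  rw [gapProd, gapProd, listProd, listProd, dif_pos hE, dif_pos hfin, hlist]
  congr 1
  refine ht.prod_map_gap_eq hΛ (E := Λ.Ext mu E) (fun a ha => ha.1) (fun a => ?_)
    (fun a => by simp)
  rw [Λ.mem_Ext_iff]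
  simp

end Gap

end StarAlgebra

end KGraph

theorem GMor.hasInit_of_comp {k : ℕ} {Λ : KGraph k} {x : GMor Λ} {F : Set Λ.Path}
    {nu b : Λ.Path} (hnu : nu ∈ F) (hb : Λ.s nu = Λ.r b) {m : Fin k → ℕ}
    (hm : ∀ i, (m i : ℕ∞) ≤ x.len i) (h : x.seg 0 m = Λ.comp nu b) : x.HasInit F := by
  have hd := x.d_seg 0 m (zero_le) hm
  rw [h, Λ.d_comp _ _ hb, tsub_zero] at hd
  have hle : Λ.d nu ≤ m := hd ▸ le_self_add
  have hlen : ∀ i, (Λ.d nu i : ℕ∞) ≤ x.len i :=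
    fun i => (Nat.cast_le.2 (hle i)).trans (hm i)
  refine ⟨nu, hnu, hlen, ?_⟩
  refine (Λ.comp_inj (b := x.seg (Λ.d nu) m) ?_ hb ?_ ?_).1
  · rw [x.s_seg _ _ (zero_le) hlen, x.r_seg _ _ hle hm]
  · rw [x.d_seg _ _ (zero_le) hlen, tsub_zero]
  · rw [x.comp_seg _ _ _ (zero_le) hle hm, h]

/-- Corollary 6.5: compressing the gap product of
`F ∈ FE(Λ) \ 𝓔` by `t_{x(0,n)} t_{x(0,n)}*` yields the gap product of
`Ext(x(0,n);F)` conjugated by `t_{x(0,n)}`, and this element is nonzero. -/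
theorem statement16 {k : ℕ} (Λ : KGraph k) (hΛ : Λ.FinitelyAligned)
    (𝓔 : Set (Set Λ.Path)) (h𝓔 : Λ.Satiated 𝓔)
    (v : Λ.Path) (F : Set Λ.Path) (hF : Λ.FEat v F) (hFne : F ∉ 𝓔)
    (x : GMor Λ) (hx : Λ.IsBdry 𝓔 x) (hxr : x.range = v) (hxF : ¬ x.HasInit F)
    (n : Fin k → ℕ) (hn : ∀ i, (n i : ℕ∞) ≤ x.len i)
    {A : Type*} [NormedRing A] [StarRing A] [CStarRing A] [NormedAlgebra ℂ A]
    [CompleteSpace A] [StarModule ℂ A]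
    (t : Λ.Path → A) (ht : Λ.RCKFamily 𝓔 t)
    (hnz : ∀ w, Λ.IsVertex w → t w ≠ 0)
    (hfe : ∀ G w, Λ.FEat w G → G ∉ 𝓔 → Λ.gapProd t w G ≠ 0) :
    Λ.gapProd t v F * (t (x.seg 0 n) * star (t (x.seg 0 n))) =
        t (x.seg 0 n) * Λ.gapProd t (x.seg n n) (Λ.Ext (x.seg 0 n) F) *
          star (t (x.seg 0 n)) ∧
      Λ.gapProd t v F * (t (x.seg 0 n) * star (t (x.seg 0 n))) ≠ 0 := by
  set mu := x.seg 0 n with hmu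
  have hd : Λ.d mu = n := by rw [hmu, x.d_seg 0 n (zero_le) hn, tsub_zero]
  have hr : Λ.r mu = v := by rw [hmu, x.r_seg 0 n (zero_le) hn]; exact hxr
  have hs : Λ.s mu = x.seg n n := x.s_seg 0 n (zero_le) hn
  have hFE : Λ.FEat (Λ.s mu) (Λ.Ext mu F) := by
    refine Λ.FEat_Ext hΛ hF hr ?_
    rintro ⟨nu, hnu, b, hb, h⟩
    exact hxF (GMor.hasInit_of_comp hnu hb hn h.symm)
  have hnot : Λ.Ext mu F ∉ 𝓔 := by
    intro hmem
    obtain ⟨a, ⟨-, nu, hnu, b, h⟩, hlen, ha⟩ := hx n hn _ hmem (hs ▸ hFE)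
    refine hxF (GMor.hasInit_of_comp hnu h.2.1 hlen ?_)
    rw [← h.2.2.1, ← x.comp_seg 0 n _ (zero_le) le_self_add hlen, ha]
  have hG := hfe _ _ hFE hnot
  rw [← hs]
  have heq : Λ.gapProd t v F * (t mu * star (t mu)) =
      t mu * Λ.gapProd t (Λ.s mu) (Λ.Ext mu F) * star (t mu) := by
    rw [← mul_assoc, ht.1.gapProd_mul hΛ hF.2.2.1 hr]
  refine ⟨heq, fun h0 => hG ?_⟩
  have hne : (Λ.Ext mu F).Nonempty := hF.2.2.2 mu hr
  rw [← ht.1.mul_gapProd_mul (fun a ha => (hFE.2.1 a ha).1) hFE.2.2.1 hne,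
    ← ht.1.star_mul_self mu]
  calc star (t mu) * t mu * Λ.gapProd t (Λ.s mu) (Λ.Ext mu F) * (star (t mu) * t mu)
      = star (t mu) * (t mu * Λ.gapProd t (Λ.s mu) (Λ.Ext mu F) * star (t mu)) * t mu := by
        simp only [mul_assoc]
    _ = 0 := by rw [← heq, h0, mul_zero, zero_mul]
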